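/- arXiv:1510.08323 — 2 statements merged into one kernel-verified Lean document; each statement's English description precedes it below -/
import Mathlib

section
/- Let 𝒟̃ be a convex set of nonnegative functions in L¹(Ω, 𝓕, P), and let Q ∈ (L^∞)^* be a positive functional belonging to the weak-star closure of the canonical embedding of 𝒟̃ into (L^∞)^*. Assume Q = Q^r + Q^s, where Q^r is the canonical embedding of some nonnegative g ∈ L¹(Ω, 𝓕, P), Q^s ∈ (L^∞)^* is positive, and for every ε > 0 there exists A ∈ 𝓕 with P(A) > 1 − ε and ⟨Q^s, 1_A⟩ = 0. Then there exists a sequence (h^n)_{n∈ℕ} in 𝒟̃ such that h^n → g P-a.s. as n → ∞. -/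
open MeasureTheory Filter Topology

section DualOfL1

variable {Ω : Type*} [MeasurableSpace Ω] {μ : Measure Ω} [IsFiniteMeasure μ]

/-- A continuous linear functional on `L¹` of a finite measure is given, on indicators, by
integration against an essentially bounded function. -/
lemma exists_Lp_top_setIntegral_eq (φ : Lp ℝ 1 μ →L[ℝ] ℝ) :
    ∃ F : Lp ℝ ⊤ μ, ∀ s (hs : MeasurableSet s),
      φ (indicatorConstLp 1 hs (measure_ne_top μ s) 1) = ∫ ω in s, F ω ∂μ := by
  let one : Lp ℝ 2 μ := indicatorConstLp 2 MeasurableSet.univ (measure_ne_top μ _) 1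
  let ι : Lp ℝ 2 μ →L[ℝ] Lp ℝ 1 μ := (ContinuousLinearMap.mul ℝ ℝ).holderL μ 2 2 1 one
  have hι : ∀ s (hs : MeasurableSet s), ι (indicatorConstLp 2 hs (measure_ne_top μ s) 1) =
      indicatorConstLp 1 hs (measure_ne_top μ s) 1 := by
    intro s hs
    refine Lp.ext ?_
    filter_upwards [(ContinuousLinearMap.mul ℝ ℝ).coeFn_holder (r := 1) one
        (indicatorConstLp 2 hs (measure_ne_top μ s) 1),
      indicatorConstLp_coeFn (p := 1) (hs := hs) (hμs := measure_ne_top μ s) (c := (1 : ℝ)),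
      indicatorConstLp_coeFn (p := 2) (hs := hs) (hμs := measure_ne_top μ s) (c := (1 : ℝ)),
      indicatorConstLp_coeFn (p := 2) (hs := MeasurableSet.univ)
        (hμs := measure_ne_top μ Set.univ) (c := (1 : ℝ))] with ω h1 h2 h3 h4
    refine h1.trans ?_
    rw [ContinuousLinearMap.mul_apply', show one ω = 1 by rw [h4]; simp, one_mul, h2, h3]
  let f : Lp ℝ 2 μ := (InnerProductSpace.toDual ℝ (Lp ℝ 2 μ)).symm (φ ∘L ι)
  have hf : ∀ s (hs : MeasurableSet s),
      φ (indicatorConstLp 1 hs (measure_ne_top μ s) 1) = ∫ ω in s, f ω ∂μ := by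
    intro s hs
    rw [← hι s hs, ← L2.inner_indicatorConstLp_one (𝕜 := ℝ) hs (measure_ne_top μ s) f,
      real_inner_comm, InnerProductSpace.toDual_symm_apply]
    rfl
  have hfi : Integrable f μ := (Lp.memLp f).integrable one_le_two
  have habs : ∀ s, MeasurableSet s → |∫ ω in s, f ω ∂μ| ≤ ∫ _ω in s, ‖φ‖ ∂μ := by
    intro s hs
    rw [← hf s hs, ← Real.norm_eq_abs]
    refine (φ.le_opNorm _).trans ?_
    rw [norm_indicatorConstLp one_ne_zero ENNReal.one_ne_top]
    simp [mul_comm]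
  have hle : f ≤ᵐ[μ] fun _ => ‖φ‖ :=
    ae_le_of_forall_setIntegral_le hfi (integrable_const _)
      fun s hs _ => (le_abs_self _).trans (habs s hs)
  have hge : (fun _ => -‖φ‖) ≤ᵐ[μ] f := by
    refine ae_le_of_forall_setIntegral_le (integrable_const _) hfi fun s hs _ => ?_
    rw [integral_neg]
    exact neg_le_of_abs_le (habs s hs)
  have hmem : MemLp f ⊤ μ := by
    refine memLp_top_of_bound (Lp.aestronglyMeasurable f) ‖φ‖ ?_
    filter_upwards [hle, hge] with ω h1 h2
    exact abs_le.2 ⟨h2, h1⟩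
  refine ⟨hmem.toLp f, fun s hs => ?_⟩
  rw [hf s hs]
  exact integral_congr_ae (ae_restrict_of_ae hmem.coeFn_toLp.symm)

/-- Every continuous linear functional on `L¹` of a finite measure is integration against an
essentially bounded function. -/
theorem exists_Lp_top_forall_apply_eq_integral (φ : Lp ℝ 1 μ →L[ℝ] ℝ) :
    ∃ F : Lp ℝ ⊤ μ, ∀ u : Lp ℝ 1 μ, φ u = ∫ ω, F ω * u ω ∂μ := by
  obtain ⟨F, hF⟩ := exists_Lp_top_setIntegral_eq φ
  let ψ : Lp ℝ 1 μ →L[ℝ] ℝ := (ContinuousLinearMap.mul ℝ ℝ).lpPairing μ ⊤ 1 F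
  have hψ : ∀ u : Lp ℝ 1 μ, ψ u = ∫ ω, F ω * u ω ∂μ := fun u =>
    (ContinuousLinearMap.mul ℝ ℝ).lpPairing_eq_integral F u
  refine ⟨F, fun u => ?_⟩
  rw [← hψ u]
  refine Lp.induction ENNReal.one_ne_top (fun u => φ u = ψ u) ?_ ?_ ?_ u
  · intro c s hs hμs
    have hc : (Lp.simpleFunc.indicatorConst 1 hs hμs.ne c : Lp ℝ 1 μ) =
        c • indicatorConstLp 1 hs (measure_ne_top μ s) (1 : ℝ) := by
      rw [Lp.simpleFunc.coe_indicatorConst]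
      refine Lp.ext ?_
      filter_upwards [indicatorConstLp_coeFn (p := 1) (hs := hs) (hμs := hμs.ne) (c := c),
        indicatorConstLp_coeFn (p := 1) (hs := hs) (hμs := measure_ne_top μ s) (c := (1 : ℝ)),
        Lp.coeFn_smul c (indicatorConstLp 1 hs (measure_ne_top μ s) (1 : ℝ))] with ω h1 h2 h3
      rw [h1, h3, Pi.smul_apply, h2]
      by_cases h : ω ∈ s <;> simp [h]
    rw [hc, map_smul, map_smul, hF s hs, hψ, ← integral_indicator hs]
    congr 1
    refine integral_congr_ae ?_
    filter_upwards [indicatorConstLp_coeFn (p := 1) (hs := hs) (hμs := measure_ne_top μ s)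
      (c := (1 : ℝ))] with ω hω
    by_cases h : ω ∈ s <;> simp [hω, h]
  · intro f g hf hg _ h1 h2
    simp only [map_add, h1, h2]
  · exact isClosed_eq φ.continuous ψ.continuous

end DualOfL1

section Singular

variable {Ω : Type*} [MeasurableSpace Ω] {P : Measure Ω} [IsFiniteMeasure P]

/-- A positive functional on `L^∞` that vanishes on `1_A` vanishes on every function supported
in `A`. -/
lemma apply_eq_zero_of_ae_eq_zero_off {R : WeakDual ℝ (Lp ℝ ⊤ P)}
    (hR : ∀ f : Lp ℝ ⊤ P, (∀ᵐ ω ∂P, 0 ≤ f ω) → 0 ≤ R f)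
    {A : Set Ω} (hA : MeasurableSet A)
    (hRA : R (indicatorConstLp ⊤ hA (measure_ne_top P A) (1 : ℝ)) = 0)
    (f : Lp ℝ ⊤ P) (hf : ∀ᵐ ω ∂P, ω ∉ A → f ω = 0) : R f = 0 := by
  set I : Lp ℝ ⊤ P := indicatorConstLp ⊤ hA (measure_ne_top P A) (1 : ℝ) with hI
  have hbd : ∀ᵐ ω ∂P, |f ω| ≤ ‖f‖ := by
    filter_upwards [ae_le_eLpNormEssSup (f := f) (μ := P)] with ω hω
    rw [Lp.norm_def, eLpNorm_exponent_top, ← Real.norm_eq_abs, ← toReal_enorm]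
    refine ENNReal.toReal_mono ?_ hω
    simpa [eLpNorm_exponent_top] using Lp.eLpNorm_ne_top f
  have hIω : ∀ᵐ ω ∂P, |f ω| ≤ (‖f‖ • I) ω := by
    filter_upwards [hbd, hf, Lp.coeFn_smul ‖f‖ I, indicatorConstLp_coeFn (p := ⊤) (hs := hA)
      (hμs := measure_ne_top P A) (c := (1 : ℝ))] with ω h1 h2 h3 h4
    rw [h3, Pi.smul_apply, hI, h4]
    by_cases h : ω ∈ A
    · simpa [h] using h1
    · simp [h, h2 h]
  have h1 := hR (‖f‖ • I - f) (by
    filter_upwards [hIω, Lp.coeFn_sub (‖f‖ • I) f] with ω h1 h2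
    rw [h2, Pi.sub_apply]
    linarith [le_abs_self (f ω)])
  have h2 := hR (‖f‖ • I + f) (by
    filter_upwards [hIω, Lp.coeFn_add (‖f‖ • I) f] with ω h1 h2
    rw [h2, Pi.add_apply]
    linarith [neg_abs_le (f ω)])
  rw [map_sub, map_smul, hRA] at h1
  rw [map_add, map_smul, hRA] at h2
  simp only [smul_zero] at h1 h2
  linarith

/-- If `Q` is the sum of integration against `g` and a functional that vanishes on functions
supported in `A`, and `Q` is in the weak-star closure of a convex set `D` of integrable functions,
then `g` is approximated in `L¹(A)` by elements of `D`. -/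
lemma exists_eLpNorm_indicator_sub_lt
    {D : Set (Ω → ℝ)} (hD : ∀ h ∈ D, Integrable h P) (hDconv : Convex ℝ D)
    {Q : WeakDual ℝ (Lp ℝ ⊤ P)}
    (hQ : Q ∈ closure {q : WeakDual ℝ (Lp ℝ ⊤ P) |
      ∃ h ∈ D, ∀ f : Lp ℝ ⊤ P, q f = ∫ ω, f ω * h ω ∂P})
    {g : Ω → ℝ} (hg : Integrable g P) {A : Set Ω} (hA : MeasurableSet A)
    (hQA : ∀ f : Lp ℝ ⊤ P, (∀ᵐ ω ∂P, ω ∉ A → f ω = 0) → Q f = ∫ ω, f ω * g ω ∂P)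
    {ε : ENNReal} (hε : 0 < ε) :
    ∃ h ∈ D, eLpNorm (A.indicator (h - g)) 1 P < ε := by
  let S : Set (Lp ℝ 1 P) := {u | ∃ h ∈ D, u =ᵐ[P] A.indicator h}
  have hS : Convex ℝ S := by
    rintro u ⟨h, hh, hu⟩ v ⟨k, hk, hv⟩ a b ha hb hab
    refine ⟨a • h + b • k, hDconv hh hk ha hb hab, ?_⟩
    filter_upwards [hu, hv, Lp.coeFn_add (a • u) (b • v), Lp.coeFn_smul a u,
      Lp.coeFn_smul b v] with ω h1 h2 h3 h4 h5
    rw [h3, Pi.add_apply, h4, h5, Pi.smul_apply, Pi.smul_apply, h1, h2]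
    by_cases h : ω ∈ A <;> simp [h]
  have hmem : ∀ {k : Ω → ℝ}, Integrable k P → MemLp (A.indicator k) 1 P := fun hk =>
    memLp_one_iff_integrable.2 (hk.indicator hA)
  have hG : (hmem hg).toLp _ ∈ closure S := by
    by_contra hG
    obtain ⟨φ, c, hφG, hφS⟩ := geometric_hahn_banach_point_closed hS.closure isClosed_closure hG
    obtain ⟨F, hF⟩ := exists_Lp_top_forall_apply_eq_integral φ
    let F' : Lp ℝ ⊤ P := ((Lp.memLp F).indicator hA).toLp _
    have hF' : F' =ᵐ[P] A.indicator F := MemLp.coeFn_toLp _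
    have hφ : ∀ {k : Ω → ℝ} (hk : Integrable k P),
        φ ((hmem hk).toLp _) = ∫ ω, F' ω * k ω ∂P := by
      intro k hk
      rw [hF]
      refine integral_congr_ae ?_
      filter_upwards [hF', (hmem hk).coeFn_toLp] with ω h1 h2
      rw [h1, h2]
      by_cases h : ω ∈ A <;> simp [h]
    have hQF : Q F' < c := by
      rw [hQA F', ← hφ hg]
      · exact hφG
      · filter_upwards [hF'] with ω h1 h2
        simp [h1, h2]
    have hopen : IsOpen {q : WeakDual ℝ (Lp ℝ ⊤ P) | q F' < c} :=
      isOpen_lt (WeakDual.eval_continuous F') continuous_const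
    obtain ⟨q, hq, h, hh, hqh⟩ := mem_closure_iff.1 hQ _ hopen hQF
    have hlt := hφS ((hmem (hD h hh)).toLp _)
      (subset_closure ⟨h, hh, (hmem (hD h hh)).coeFn_toLp⟩)
    rw [hφ (hD h hh), ← hqh F'] at hlt
    exact lt_asymm hlt hq
  obtain ⟨u, ⟨h, hh, hu⟩, hd⟩ := EMetric.mem_closure_iff.1 hG ε hε
  refine ⟨h, hh, ?_⟩
  rw [edist_comm, Lp.edist_def] at hd
  refine (eLpNorm_congr_ae ?_).trans_lt hd
  filter_upwards [hu, (hmem hg).coeFn_toLp] with ω h1 h2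
  rw [Pi.sub_apply, h1, h2, Set.indicator_sub']
  rfl

end Singular

/-- Convergence in `L¹` on sets whose complements have measure tending to zero implies convergence
in measure. -/
lemma tendstoInMeasure_of_tendsto_eLpNorm_indicator
    {Ω : Type*} [MeasurableSpace Ω] {μ : Measure Ω} {h : ℕ → Ω → ℝ} {g : Ω → ℝ} {A : ℕ → Set Ω}
    (hA : ∀ n, MeasurableSet (A n)) (hh : ∀ n, AEStronglyMeasurable (h n) μ)
    (hg : AEStronglyMeasurable g μ) (hAc : Tendsto (fun n => μ (A n)ᶜ) atTop (𝓝 0))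
    (hlim : Tendsto (fun n => eLpNorm ((A n).indicator (h n - g)) 1 μ) atTop (𝓝 0)) :
    TendstoInMeasure μ h atTop g := by
  have hind : TendstoInMeasure μ (fun n => (A n).indicator (h n - g)) atTop 0 :=
    tendstoInMeasure_of_tendsto_eLpNorm one_ne_zero
      (fun n => ((hh n).sub hg).indicator (hA n)) aestronglyMeasurable_zero (by simpa using hlim)
  intro δ hδ
  refine tendsto_of_tendsto_of_tendsto_of_le_of_le tendsto_const_nhds
    (by simpa using hAc.add (hind δ hδ)) (fun _ => zero_le) fun n => ?_
  refine (measure_mono fun ω hω => ?_).trans (measure_union_le _ _)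
  by_cases h : ω ∈ A n
  · right
    simpa [h, edist_eq_enorm_sub] using hω
  · exact Or.inl h

/-- Proposition 5.1: if `Q` lies in the weak-star closure (in `(L^∞)^*`) of the canonical
embedding of a convex set `D` of nonnegative `L¹` functions, and `Q = Qr + Qs` is its
Yosida–Hewitt decomposition with regular part given by integration against `g ∈ L¹`,
then some sequence from `D` converges to `g` almost surely. -/
theorem exists_seq_tendsto_ae_of_mem_weakStar_closure
    {Ω : Type*} [MeasurableSpace Ω] (P : Measure Ω) [IsProbabilityMeasure P]
    (D : Set (Ω → ℝ))
    (hD : ∀ h ∈ D, Integrable h P ∧ 0 ≤ᵐ[P] h)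
    (hDconv : Convex ℝ D)
    (Q Qr Qs : WeakDual ℝ (Lp ℝ ⊤ P))
    (hQpos : ∀ f : Lp ℝ ⊤ P, (∀ᵐ ω ∂P, 0 ≤ f ω) → 0 ≤ Q f)
    (hQclosure : Q ∈ closure {q : WeakDual ℝ (Lp ℝ ⊤ P) |
      ∃ h ∈ D, ∀ f : Lp ℝ ⊤ P, q f = ∫ ω, f ω * h ω ∂P})
    (g : Ω → ℝ) (hg_int : Integrable g P) (hg_nonneg : 0 ≤ᵐ[P] g)
    (hdecomp : Q = Qr + Qs)
    (hQr : ∀ f : Lp ℝ ⊤ P, Qr f = ∫ ω, f ω * g ω ∂P)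
    (hQs_pos : ∀ f : Lp ℝ ⊤ P, (∀ᵐ ω ∂P, 0 ≤ f ω) → 0 ≤ Qs f)
    (hQs_sing : ∀ ε > (0 : ℝ), ∃ A : Set Ω, ∃ hA : MeasurableSet A,
      (P A).toReal > 1 - ε ∧
      Qs (indicatorConstLp ⊤ hA (measure_ne_top P A) (1 : ℝ)) = 0) :
    ∃ h : ℕ → Ω → ℝ, (∀ n, h n ∈ D) ∧
      ∀ᵐ ω ∂P, Tendsto (fun n => h n ω) atTop (𝓝 (g ω)) := by
  have happrox : ∀ n : ℕ, ∃ h ∈ D, ∃ A : Set Ω, MeasurableSet A ∧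
      P Aᶜ ≤ ENNReal.ofReal (1 / ((n : ℝ) + 1)) ∧
      eLpNorm (A.indicator (h - g)) 1 P < ENNReal.ofReal (1 / ((n : ℝ) + 1)) := by
    intro n
    have hn : (0 : ℝ) < 1 / ((n : ℝ) + 1) := by positivity
    obtain ⟨A, hA, hPA, hQsA⟩ := hQs_sing _ hn
    obtain ⟨h, hh, hlt⟩ := exists_eLpNorm_indicator_sub_lt (fun k hk => (hD k hk).1) hDconv
      hQclosure hg_int hA (fun f hf => by
        rw [hdecomp, ← hQr f, ← add_zero (Qr f),
          ← apply_eq_zero_of_ae_eq_zero_off hQs_pos hA hQsA f hf]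
        rfl) (ENNReal.ofReal_pos.2 hn)
    refine ⟨h, hh, A, hA, ?_, hlt⟩
    rw [← ofReal_measureReal, probReal_compl_eq_one_sub hA]
    refine ENNReal.ofReal_le_ofReal ?_
    change 1 - (P A).toReal ≤ _
    linarith
  choose h hh A hA hPA hlt using happrox
  have hzero : Tendsto (fun n : ℕ => ENNReal.ofReal (1 / ((n : ℝ) + 1))) atTop (𝓝 0) := by
    simpa using ENNReal.tendsto_ofReal tendsto_one_div_add_atTop_nhds_zero_nat
  obtain ⟨ns, -, hns⟩ := (tendstoInMeasure_of_tendsto_eLpNorm_indicator hA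
    (fun n => (hD _ (hh n)).1.aestronglyMeasurable) hg_int.aestronglyMeasurable
    (tendsto_of_tendsto_of_tendsto_of_le_of_le tendsto_const_nhds hzero (fun _ => zero_le) hPA)
    (tendsto_of_tendsto_of_tendsto_of_le_of_le tendsto_const_nhds hzero (fun _ => zero_le)
      fun n => (hlt n).le)).exists_seq_tendsto_ae
  exact ⟨fun n => h (ns n), fun n => hh _, hns⟩
end

section
/- Let 𝒟̃ be a convex subset of L¹(Ω, 𝓕, P), and let Q ∈ (L^∞)^* belong to the weak-star closure of the canonical embedding of 𝒟̃ into (L^∞)^*. Let A ∈ 𝓕 and g ∈ L¹(Ω, 𝓕, P) be such that ⟨Q, f·1_A⟩ = E[f·1_A·g] for every f ∈ L^∞. Then g·1_A belongs to the L¹-norm closure of the set {h·1_A : h ∈ 𝒟̃}. -/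
open MeasureTheory Filter Topology

/-- The density of the restriction to `L²` of a continuous linear functional on `L¹`, given by the
Riesz representation theorem. -/
lemma exists_L2_representative {Ω : Type*} [MeasurableSpace Ω] (P : Measure Ω)
    [IsProbabilityMeasure P] (l : StrongDual ℝ (Lp ℝ 1 P)) :
    ∃ φ : Lp ℝ 2 P, ∀ (s : Set Ω) (hs : MeasurableSet s),
      l (indicatorConstLp 1 hs (measure_ne_top P s) 1) = ∫ ω in s, φ ω ∂P := by
  let T : Lp ℝ 2 P →L[ℝ] Lp ℝ 1 P :=
    (ContinuousLinearMap.mul ℝ ℝ).holderL P 2 2 1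
      (indicatorConstLp 2 MeasurableSet.univ (measure_ne_top P _) 1)
  refine ⟨(InnerProductSpace.toDual ℝ (Lp ℝ 2 P)).symm (l.comp T), fun s hs => ?_⟩
  rw [← L2.inner_indicatorConstLp_one (𝕜 := ℝ) hs (measure_ne_top P s), real_inner_comm,
    InnerProductSpace.toDual_symm_apply, ContinuousLinearMap.comp_apply]
  congr 1
  refine Lp.ext ?_
  refine indicatorConstLp_coeFn.trans ?_
  refine EventuallyEq.trans ?_ (ContinuousLinearMap.coeFn_holder _ _ _).symm
  filter_upwards [indicatorConstLp_coeFn (p := 2) (hs := hs) (hμs := measure_ne_top P s)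
    (c := (1 : ℝ)), Lp.coeFn_const (p := 2) (μ := P) (1 : ℝ)] with ω h₁ _
  simp_all

/-- Every continuous linear functional on `L¹` of a probability space is integration against an
essentially bounded function. -/
lemma exists_Linfty_representative {Ω : Type*} [MeasurableSpace Ω] (P : Measure Ω)
    [IsProbabilityMeasure P] (l : StrongDual ℝ (Lp ℝ 1 P)) :
    ∃ φ : Lp ℝ ⊤ P, ∀ f : Lp ℝ 1 P, l f = ∫ ω, φ ω * f ω ∂P := by
  obtain ⟨φ, hφ⟩ := exists_L2_representative P l
  have hφint : Integrable φ P := (Lp.memLp φ).integrable (by norm_num)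
  have hbound : ∀ (s : Set Ω), MeasurableSet s → |∫ ω in s, φ ω ∂P| ≤ ∫ ω in s, ‖l‖ ∂P := by
    intro s hs
    rw [← hφ s hs, ← Real.norm_eq_abs]
    refine (l.le_opNorm _).trans (le_of_eq ?_)
    rw [norm_indicatorConstLp one_ne_zero ENNReal.one_ne_top]
    simp [mul_comm]
  have hle : φ ≤ᵐ[P] fun _ => ‖l‖ :=
    ae_le_of_forall_setIntegral_le hφint (integrable_const _)
      fun s hs _ => (le_abs_self _).trans (hbound s hs)
  have hge : (fun ω => -φ ω) ≤ᵐ[P] fun _ => ‖l‖ := by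
    refine ae_le_of_forall_setIntegral_le hφint.neg (integrable_const _) fun s hs _ => ?_
    rw [integral_neg]
    exact (neg_le_abs _).trans (hbound s hs)
  have hmem : MemLp φ ⊤ P := by
    refine memLp_top_of_bound (Lp.aestronglyMeasurable φ) ‖l‖ ?_
    filter_upwards [hle, hge] with ω h₁ h₂
    exact abs_le'.2 ⟨h₁, h₂⟩
  let ψ : Lp ℝ ⊤ P := hmem.toLp φ
  let L : StrongDual ℝ (Lp ℝ 1 P) := (ContinuousLinearMap.mul ℝ ℝ).lpPairing P ⊤ 1 ψ
  have hL : ∀ f, L f = ∫ ω, ψ ω * f ω ∂P := fun f =>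
    ContinuousLinearMap.lpPairing_eq_integral _ _ _
  refine ⟨ψ, fun f => ?_⟩
  rw [← hL]
  induction f using Lp.induction ENNReal.one_ne_top with
  | indicatorConst c hs hμs =>
    rename_i s
    have hc : ((Lp.simpleFunc.indicatorConst 1 hs hμs.ne c : Lp.simpleFunc ℝ 1 P) : Lp ℝ 1 P)
        = c • indicatorConstLp 1 hs (measure_ne_top P s) (1 : ℝ) := by
      rw [Lp.simpleFunc.coe_indicatorConst]
      refine Lp.ext ?_
      filter_upwards [Lp.coeFn_smul c (indicatorConstLp 1 hs (measure_ne_top P s) (1 : ℝ)),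
        indicatorConstLp_coeFn (p := 1) (hs := hs) (hμs := measure_ne_top P s) (c := (1 : ℝ)),
        indicatorConstLp_coeFn (p := 1) (hs := hs) (hμs := hμs.ne) (c := c)] with ω h₁ h₂ h₃
      rw [h₁, h₃, Pi.smul_apply, h₂]
      by_cases hω : ω ∈ s <;> simp [hω]
    rw [hc, map_smul, map_smul, hφ s hs, hL, ← integral_indicator hs]
    congr 1
    refine integral_congr_ae ?_
    filter_upwards [hmem.coeFn_toLp,
      indicatorConstLp_coeFn (p := 1) (hs := hs) (hμs := measure_ne_top P s) (c := (1 : ℝ))]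
      with ω h₁ h₂
    rw [h₁, h₂]
    by_cases hω : ω ∈ s <;> simp [hω]
  | add hf hg _ ihf ihg => rw [map_add, map_add, ihf, ihg]
  | isClosed => exact isClosed_eq l.continuous L.continuous

/-- Key intermediate step of Proposition 5.1: if `Q` is a weak-star limit point of the
canonical embedding of the convex set `D ⊆ L¹` and `Q` acts on functions supported on `A`
by integration against `g`, then `g · 1_A` lies in the `L¹`-closure of `{h · 1_A : h ∈ D}`. -/
theorem indicator_mem_L1_closure_of_weakStar_limit
    {Ω : Type*} [MeasurableSpace Ω] (P : Measure Ω) [IsProbabilityMeasure P]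
    (D : Set (Ω → ℝ)) (hD : ∀ h ∈ D, Integrable h P) (hDconv : Convex ℝ D)
    (Q : WeakDual ℝ (Lp ℝ ⊤ P))
    (hQclosure : Q ∈ closure {q : WeakDual ℝ (Lp ℝ ⊤ P) |
      ∃ h ∈ D, ∀ f : Lp ℝ ⊤ P, q f = ∫ ω, f ω * h ω ∂P})
    (A : Set Ω) (hA : MeasurableSet A)
    (g : Ω → ℝ) (hg : Integrable g P)
    (hQA : ∀ f fA : Lp ℝ ⊤ P, (fA : Ω → ℝ) =ᵐ[P] A.indicator (fun ω => f ω) →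
      Q fA = ∫ ω, A.indicator (fun ω' => f ω') ω * g ω ∂P) :
    ∀ ε > (0 : ℝ), ∃ h ∈ D,
      ∫ ω, |A.indicator h ω - A.indicator g ω| ∂P < ε := by
  let S : Set (Lp ℝ 1 P) := {F | ∃ h ∈ D, F =ᵐ[P] A.indicator h}
  have hS : Convex ℝ S := by
    rintro F ⟨h, hh, hF⟩ G ⟨k, hk, hG⟩ a b ha hb hab
    refine ⟨a • h + b • k, hDconv hh hk ha hb hab, ?_⟩
    filter_upwards [Lp.coeFn_add (a • F) (b • G), Lp.coeFn_smul a F, Lp.coeFn_smul b G, hF, hG]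
      with ω h₁ h₂ h₃ h₄ h₅
    rw [h₁, Pi.add_apply, h₂, h₃, Pi.smul_apply, Pi.smul_apply, h₄, h₅]
    by_cases hω : ω ∈ A <;> simp [hω]
  have hgA : Integrable (A.indicator g) P := hg.indicator hA
  have hmem : hgA.toL1 ∈ closure S := by
    by_contra hnot
    obtain ⟨l, u, hlS, hlg⟩ :=
      geometric_hahn_banach_closed_point hS.closure isClosed_closure hnot
    obtain ⟨φ, hφ⟩ := exists_Linfty_representative P l
    let φA : Lp ℝ ⊤ P := ((Lp.memLp φ).indicator hA).toLp _
    have hφA : φA =ᵐ[P] A.indicator φ := MemLp.coeFn_toLp _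
    have hQ : Q φA ≤ u := by
      have hclosed : IsClosed {q : WeakDual ℝ (Lp ℝ ⊤ P) | q φA ≤ u} :=
        isClosed_le (WeakDual.eval_continuous φA) continuous_const
      refine closure_minimal ?_ hclosed hQclosure
      rintro q ⟨h, hh, hq⟩
      have hhA : Integrable (A.indicator h) P := (hD h hh).indicator hA
      have hlt := hlS _ (subset_closure ⟨h, hh, hhA.coeFn_toL1⟩)
      rw [hφ] at hlt
      refine le_of_eq_of_le ?_ hlt.le
      rw [hq]
      refine integral_congr_ae ?_
      filter_upwards [hφA, hhA.coeFn_toL1] with ω h₁ h₂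
      rw [h₁, h₂]
      by_cases hω : ω ∈ A <;> simp [hω]
    refine hlg.not_ge (le_of_eq_of_le ?_ hQ)
    rw [hφ, hQA φ φA hφA]
    refine integral_congr_ae ?_
    filter_upwards [hgA.coeFn_toL1] with ω h₁
    rw [h₁]
    by_cases hω : ω ∈ A <;> simp [hω]
  intro ε hε
  obtain ⟨F, ⟨h, hh, hF⟩, hdist⟩ := Metric.mem_closure_iff.1 hmem ε hε
  refine ⟨h, hh, lt_of_eq_of_lt ?_ hdist⟩
  rw [dist_comm, dist_eq_norm, L1.norm_eq_integral_norm]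
  refine integral_congr_ae ?_
  filter_upwards [Lp.coeFn_sub F hgA.toL1, hF, hgA.coeFn_toL1] with ω h₁ h₂ h₃
  rw [h₁, Pi.sub_apply, h₂, h₃, Real.norm_eq_abs]
end
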